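/- Let k ≥ 1 be an integer, let a : ℝ → ℝ be bounded with bounded derivatives up to order 2k (a ∈ C_b^{2k}(ℝ)), and let φ ∈ C_c^∞(ℝ). Define F_k(t) = (A(t^{1/(2k)}) − I)^k ∘ B_a ∘ (I − A(t^{1/(2k)})*)^k for t ≥ 0. Then F_k(t)φ = t · (d^k/dx^k)(a·φ^{(k)}) + o(t) in L²(ℝ) as t → 0+; explicitly, lim_{t→0+} t^{−1} · ‖F_k(t)φ − t·(d^k/dx^k)(x ↦ a(x)·φ^{(k)}(x))‖_{L²(ℝ)} = 0. -/

import Mathlib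

open MeasureTheory Filter
open scoped ENNReal Topology

noncomputable abbrev H1 : Type := Lp ℂ 2 (volume : Measure ℝ)

/-- Generalized difference operator. -/
def Df (c d : ℝ) (g : ℝ → ℝ) : ℝ → ℝ := fun x => g (x + c) - g (x + d)

lemma Df_contDiff (c d : ℝ) (m : WithTop ℕ∞) (n : ℕ) (g : ℝ → ℝ) (hg : ContDiff ℝ m g) :
    ContDiff ℝ m ((Df c d)^[n] g) := by
  induction n generalizing g with
  | zero => simpa using hg
  | succ n ih =>
    rw [Function.iterate_succ_apply]
    apply ih
    unfold Df
    exact (hg.comp (contDiff_id.add contDiff_const)).sub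
      (hg.comp (contDiff_id.add contDiff_const))

lemma Df_iteratedDeriv_one (c d : ℝ) (j : ℕ) (g : ℝ → ℝ) (hg : ContDiff ℝ j g) :
    iteratedDeriv j (Df c d g) = Df c d (iteratedDeriv j g) := by
  funext x
  unfold Df
  have h1 : ∀ c : ℝ, ContDiff ℝ j (fun x => g (x + c)) := fun c =>
    hg.comp (contDiff_id.add contDiff_const)
  rw [iteratedDeriv_fun_sub (h1 c).contDiffAt (h1 d).contDiffAt,
    iteratedDeriv_comp_add_const, iteratedDeriv_comp_add_const]

lemma Df_iteratedDeriv (c d : ℝ) (j n : ℕ) (g : ℝ → ℝ) (hg : ContDiff ℝ j g) :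
    iteratedDeriv j ((Df c d)^[n] g) = (Df c d)^[n] (iteratedDeriv j g) := by
  induction n with
  | zero => rfl
  | succ n ih =>
    rw [Function.iterate_succ_apply', Function.iterate_succ_apply',
      Df_iteratedDeriv_one _ _ _ _ (Df_contDiff c d j n g hg), ih]

lemma Df_mvt (c d r : ℝ) (hdc : d < c) (hc : |c| ≤ r) (hd : |d| ≤ r) (n : ℕ) (g : ℝ → ℝ)
    (hg : ContDiff ℝ n g) (x : ℝ) :
    ∃ ξ, |ξ - x| ≤ n * r ∧ (Df c d)^[n] g x = (c - d) ^ n * iteratedDeriv n g ξ := by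
  induction n generalizing g x with
  | zero => exact ⟨x, by simp, by simp⟩
  | succ n ih =>
    have hgn : ContDiff ℝ n g := hg.of_le (by exact_mod_cast Nat.le_succ n)
    obtain ⟨ξ, h1, h2⟩ := ih (Df c d g) (Df_contDiff c d n 1 g hgn) x
    have hD : Differentiable ℝ (iteratedDeriv n g) :=
      hg.differentiable_iteratedDeriv n (by exact_mod_cast Nat.lt_succ_self n)
    obtain ⟨η, ⟨h3, h3'⟩, h4⟩ := exists_deriv_eq_slope (iteratedDeriv n g)
      (show ξ + d < ξ + c by linarith) hD.continuous.continuousOn hD.differentiableOn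
    refine ⟨η, ?_, ?_⟩
    · rw [abs_le] at *
      push_cast
      constructor <;> linarith
    · rw [Function.iterate_succ_apply, h2, Df_iteratedDeriv_one _ _ _ _ hgn, iteratedDeriv_succ, h4]
      have : c - d ≠ 0 := by linarith
      have h5 : ξ + c - (ξ + d) = c - d := by ring
      rw [h5]
      unfold Df
      field_simp
      ring

lemma iteratedDeriv_iteratedDeriv' (m n : ℕ) (f : ℝ → ℝ) :
    iteratedDeriv m (iteratedDeriv n f) = iteratedDeriv n (iteratedDeriv m f) := by
  simp only [iteratedDeriv_eq_iterate]
  rw [← Function.iterate_add_apply, ← Function.iterate_add_apply, add_comm]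

lemma smooth_iteratedDeriv (n : ℕ) (f : ℝ → ℝ) (hf : ContDiff ℝ (⊤ : ℕ∞) f) :
    ContDiff ℝ (⊤ : ℕ∞) (iteratedDeriv n f) := by
  rw [iteratedDeriv_eq_iterate]
  exact hf.iterate_deriv n

lemma tsupport_iteratedDeriv' (n : ℕ) (f : ℝ → ℝ) :
    tsupport (iteratedDeriv n f) ⊆ tsupport f := by
  induction n with
  | zero => simp
  | succ n ih =>
    rw [iteratedDeriv_succ]
    exact (closure_minimal support_deriv_subset (isClosed_tsupport _)).trans ih

lemma rep (k : ℕ) (a φ : ℝ → ℝ) (ha : ContDiff ℝ k a)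
    (hφ : ContDiff ℝ (⊤ : ℕ∞) φ) (s : ℝ) (hs : 0 < s) (x : ℝ) :
    ∃ ξ : ℝ, ∃ η : ℕ → ℝ, |ξ - x| ≤ 2 * k * s ∧ (∀ i, |η i - x| ≤ 2 * k * s) ∧
      (Df s 0)^[k] (fun y => a y * (Df 0 (-s))^[k] φ y) x = s ^ (2 * k) *
        ∑ i ∈ Finset.range (k + 1), (k.choose i : ℝ) * iteratedDeriv i a ξ *
          iteratedDeriv (k - i) (iteratedDeriv k φ) (η i) := by
  have hle : ∀ m : ℕ, (m : WithTop ℕ∞) ≤ ((⊤ : ℕ∞) : WithTop ℕ∞) := fun m => by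
    exact_mod_cast le_top
  have hE : ContDiff ℝ k ((Df 0 (-s))^[k] φ) := Df_contDiff _ _ _ _ _ (hφ.of_le (hle k))
  obtain ⟨ξ, h1, h2⟩ := Df_mvt s 0 s hs (abs_of_pos hs).le (by simpa using hs.le) k
    (fun y => a y * (Df 0 (-s))^[k] φ y) (ha.mul hE) x
  have h3 : ∀ i : ℕ, ∃ η, |η - ξ| ≤ k * s ∧ (Df 0 (-s))^[k] (iteratedDeriv (k - i) φ) ξ =
      s ^ k * iteratedDeriv k (iteratedDeriv (k - i) φ) η := fun i => by
    have := Df_mvt 0 (-s) s (by linarith) (by simpa using hs.le)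
      (by rw [abs_neg]; exact (abs_of_pos hs).le) k (iteratedDeriv (k - i) φ)
      ((smooth_iteratedDeriv _ _ hφ).of_le (hle k)) ξ
    simpa using this
  choose η h4 h5 using h3
  have hks : 0 ≤ k * s := by positivity
  refine ⟨ξ, η, by linarith, fun i => ?_, ?_⟩
  · have := abs_sub_le (η i) ξ x
    linarith [h4 i]
  · rw [h2, iteratedDeriv_fun_mul ha.contDiffAt hE.contDiffAt, sub_zero, Finset.mul_sum,
      Finset.mul_sum]
    refine Finset.sum_congr rfl fun i _ => ?_
    rw [Df_iteratedDeriv _ _ _ _ _ (hφ.of_le (hle _)), h5, iteratedDeriv_iteratedDeriv' k]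
    ring

lemma tendsto_rep (k : ℕ) (a φ : ℝ → ℝ) (ha : ContDiff ℝ k a)
    (hφ : ContDiff ℝ (⊤ : ℕ∞) φ) (x : ℝ) :
    Tendsto (fun s : ℝ => (s ^ (2 * k))⁻¹ *
      (Df s 0)^[k] (fun y => a y * (Df 0 (-s))^[k] φ y) x) (𝓝[>] 0)
      (𝓝 (iteratedDeriv k (fun y => a y * iteratedDeriv k φ y) x)) := by
  have hle : ∀ m : ℕ, (m : WithTop ℕ∞) ≤ ((⊤ : ℕ∞) : WithTop ℕ∞) := fun m => by
    exact_mod_cast le_top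
  have H : ∀ s : ℝ, ∃ ξ : ℝ, ∃ η : ℕ → ℝ, 0 < s → (|ξ - x| ≤ 2 * k * s ∧
      (∀ i, |η i - x| ≤ 2 * k * s) ∧
      (Df s 0)^[k] (fun y => a y * (Df 0 (-s))^[k] φ y) x = s ^ (2 * k) *
        ∑ i ∈ Finset.range (k + 1), (k.choose i : ℝ) * iteratedDeriv i a ξ *
          iteratedDeriv (k - i) (iteratedDeriv k φ) (η i)) := fun s => by
    by_cases hs : 0 < s
    · obtain ⟨ξ, η, h⟩ := rep k a φ ha hφ s hs x
      exact ⟨ξ, η, fun _ => h⟩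
    · exact ⟨0, 0, fun h => absurd h hs⟩
  choose ξ η H using H
  have hpos : ∀ᶠ s : ℝ in 𝓝[>] 0, 0 < s := eventually_mem_nhdsWithin
  have h0 : Tendsto (fun s : ℝ => 2 * k * s) (𝓝[>] 0) (𝓝 0) := by
    have : Tendsto (fun s : ℝ => 2 * k * s) (𝓝 0) (𝓝 (2 * k * 0)) :=
      (continuous_const.mul continuous_id).tendsto 0
    rw [mul_zero] at this
    exact this.mono_left nhdsWithin_le_nhds
  have hlim : ∀ u : ℝ → ℝ, (∀ s, 0 < s → |u s - x| ≤ 2 * k * s) →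
      Tendsto u (𝓝[>] 0) (𝓝 x) := fun u hu => by
    rw [tendsto_iff_dist_tendsto_zero]
    refine squeeze_zero' (Eventually.of_forall fun _ => dist_nonneg) ?_ h0
    filter_upwards [hpos] with s hs
    rw [Real.dist_eq]
    exact hu s hs
  have hξ := hlim ξ fun s hs => (H s hs).1
  have hη := fun i => hlim (fun s => η s i) fun s hs => (H s hs).2.1 i
  rw [iteratedDeriv_fun_mul ha.contDiffAt
    ((smooth_iteratedDeriv _ _ hφ).of_le (hle k)).contDiffAt]
  have T : Tendsto (fun s => ∑ i ∈ Finset.range (k + 1),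
      (k.choose i : ℝ) * iteratedDeriv i a (ξ s) *
          iteratedDeriv (k - i) (iteratedDeriv k φ) (η s i)) (𝓝[>] 0)
      (𝓝 (∑ i ∈ Finset.range (k + 1), (k.choose i : ℝ) * iteratedDeriv i a x *
          iteratedDeriv (k - i) (iteratedDeriv k φ) x)) := by
    refine tendsto_finsetSum _ fun i hi => ?_
    have hi' : i ≤ k := by have := Finset.mem_range.1 hi; omega
    have ca : Continuous (iteratedDeriv i a) := ha.continuous_iteratedDeriv i (by exact_mod_cast hi')
    have cp : Continuous (iteratedDeriv (k - i) (iteratedDeriv k φ)) :=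
      (smooth_iteratedDeriv _ _ (smooth_iteratedDeriv _ _ hφ)).continuous
    exact (tendsto_const_nhds.mul ((ca.tendsto x).comp hξ)).mul ((cp.tendsto x).comp (hη i))
  refine T.congr' ?_
  filter_upwards [hpos] with s hs
  rw [(H s hs).2.2]
  have : s ^ (2 * k) ≠ 0 := by positivity
  field_simp

lemma bound_rep (k : ℕ) (a φ : ℝ → ℝ) (ha : ContDiff ℝ k a)
    (ha_bdd : ∀ i ≤ k, ∃ C : ℝ, ∀ x : ℝ, |iteratedDeriv i a x| ≤ C)
    (hφ : ContDiff ℝ (⊤ : ℕ∞) φ) (hφc : HasCompactSupport φ) :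
    ∃ M R : ℝ, ∀ s : ℝ, 0 < s → s ≤ 1 → ∀ x : ℝ, |(s ^ (2 * k))⁻¹ *
      (Df s 0)^[k] (fun y => a y * (Df 0 (-s))^[k] φ y) x| ≤
      (Metric.closedBall (0 : ℝ) R).indicator (fun _ => M) x := by
  have hA : ∀ i : ℕ, ∃ C : ℝ, i ≤ k → ∀ x : ℝ, |iteratedDeriv i a x| ≤ C := fun i => by
    by_cases h : i ≤ k
    · obtain ⟨C, hC⟩ := ha_bdd i h
      exact ⟨C, fun _ => hC⟩
    · exact ⟨0, fun h' => absurd h' h⟩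
  choose C hC using hA
  have hts : ∀ i, tsupport (iteratedDeriv (k - i) (iteratedDeriv k φ)) ⊆ tsupport φ := fun i =>
    (tsupport_iteratedDeriv' _ _).trans (tsupport_iteratedDeriv' _ _)
  have hP : ∀ i : ℕ, ∃ D : ℝ, ∀ x, |iteratedDeriv (k - i) (iteratedDeriv k φ) x| ≤ D := fun i => by
    have cp : Continuous (iteratedDeriv (k - i) (iteratedDeriv k φ)) :=
      (smooth_iteratedDeriv _ _ (smooth_iteratedDeriv _ _ hφ)).continuous
    have cs : HasCompactSupport (iteratedDeriv (k - i) (iteratedDeriv k φ)) :=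
      IsCompact.of_isClosed_subset hφc (isClosed_tsupport _) (hts i)
    obtain ⟨D, hD⟩ := cp.bounded_above_of_compact_support cs
    exact ⟨D, hD⟩
  choose D hD using hP
  obtain ⟨R, hR⟩ := hφc.isBounded.subset_closedBall (0 : ℝ)
  refine ⟨∑ i ∈ Finset.range (k + 1), (k.choose i : ℝ) * C i * D i, R + 2 * k, ?_⟩
  intro s hs hs1 x
  obtain ⟨ξ, η, h1, h2, h3⟩ := rep k a φ ha hφ s hs x
  have hne : s ^ (2 * k) ≠ 0 := by positivity
  rw [h3, inv_mul_cancel_left₀ hne]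
  by_cases hx : x ∈ Metric.closedBall (0 : ℝ) (R + 2 * k)
  · rw [Set.indicator_of_mem hx]
    refine (Finset.abs_sum_le_sum_abs _ _).trans (Finset.sum_le_sum fun i hi => ?_)
    have hi' : i ≤ k := by have := Finset.mem_range.1 hi; omega
    rw [abs_mul, abs_mul, Nat.abs_cast]
    have hC0 : 0 ≤ C i := (abs_nonneg _).trans (hC i hi' 0)
    gcongr
    · exact hC i hi' _
    · exact hD i _
  · rw [Set.indicator_of_notMem hx, Finset.sum_eq_zero, abs_zero]
    intro i _
    have : iteratedDeriv (k - i) (iteratedDeriv k φ) (η i) = 0 := by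
      apply image_eq_zero_of_notMem_tsupport
      intro hm
      apply hx
      have h5 := hR (hts i hm)
      rw [mem_closedBall_zero_iff, Real.norm_eq_abs] at h5 ⊢
      have h6 := abs_sub_le x (η i) 0
      rw [sub_zero, sub_zero, abs_sub_comm x] at h6
      have h7 : 2 * k * s ≤ 2 * (k : ℝ) * 1 := by gcongr
      linarith [h2 i]
    rw [this, mul_zero]

lemma iteratedDeriv_ofReal' (n : ℕ) (g : ℝ → ℝ) (hg : ContDiff ℝ n g) :
    iteratedDeriv n (fun x => (g x : ℂ)) = fun x => ((iteratedDeriv n g x : ℝ) : ℂ) := by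
  induction n with
  | zero => simp
  | succ n ih =>
    have hgn : ContDiff ℝ n g := hg.of_le (by exact_mod_cast Nat.le_succ n)
    have hD : Differentiable ℝ (iteratedDeriv n g) :=
      hg.differentiable_iteratedDeriv n (by exact_mod_cast Nat.lt_succ_self n)
    rw [iteratedDeriv_succ, iteratedDeriv_succ, ih hgn]
    funext x
    exact (hD x).hasDerivAt.ofReal_comp.deriv

lemma op_iter (T : H1 →L[ℂ] H1) (c d : ℝ)
    (hT : ∀ f : H1, ∀ g : ℝ → ℝ, ⇑f =ᵐ[volume] (fun x => (g x : ℂ)) →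
      ⇑(T f) =ᵐ[volume] fun x => ((Df c d g x : ℝ) : ℂ)) (n : ℕ)
    (f : H1) (g : ℝ → ℝ) (hfg : ⇑f =ᵐ[volume] (fun x => (g x : ℂ))) :
    ⇑((T ^ n) f) =ᵐ[volume] fun x => (((Df c d)^[n] g x : ℝ) : ℂ) := by
  induction n with
  | zero => simpa using hfg
  | succ n ih =>
    rw [pow_succ', Function.iterate_succ_apply']
    exact hT _ _ ih

lemma ae_shift (f : H1) (g : ℝ → ℝ) (hfg : ⇑f =ᵐ[volume] (fun x => (g x : ℂ))) (c : ℝ) :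
    (fun x => f (x + c)) =ᵐ[volume] fun x => (g (x + c) : ℂ) :=
  (measurePreserving_add_right volume c).quasiMeasurePreserving.ae_eq_comp hfg

lemma norm_sq_L2 (f : H1) (g : ℝ → ℝ) (hfg : ⇑f =ᵐ[volume] (fun x => (g x : ℂ))) :
    ‖f‖ ^ 2 = ∫ x, (g x) ^ 2 := by
  have h := L2.inner_def (𝕜 := ℂ) f f
  rw [inner_self_eq_norm_sq_to_K] at h
  have h2 : (∫ x, inner ℂ (f x) (f x)) = ∫ x, (((g x) ^ 2 : ℝ) : ℂ) := by
    apply integral_congr_ae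
    filter_upwards [hfg] with x hx
    rw [hx, inner_self_eq_norm_sq_to_K]
    simp [← Complex.ofReal_pow]
  rw [h2, integral_complex_ofReal] at h
  apply Complex.ofReal_injective
  rw [Complex.ofReal_pow]
  exact h

/-- For `k ≥ 1`, `a ∈ C_b^{2k}(ℝ)`, `φ ∈ C_c^∞(ℝ)` and
`F_k(t) = (A(t^{1/(2k)}) − I)^k ∘ B_a ∘ (I − A(t^{1/(2k)})*)^k`, one has
`F_k(t)φ = t (d^k/dx^k)(a · φ^{(k)}) + o(t)` in `L²(ℝ)` as `t → 0+`. -/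
theorem statement8
    (k : ℕ) (hk : 1 ≤ k)
    (a : ℝ → ℝ)
    (ha : ContDiff ℝ (2 * k : ℕ) a)
    (ha_bdd : ∀ i ≤ 2 * k, ∃ C : ℝ, ∀ x : ℝ, |iteratedDeriv i a x| ≤ C)
    (φ : ℝ → ℝ)
    (hφ : ContDiff ℝ (⊤ : ℕ∞) φ) (hφc : HasCompactSupport φ)
    (A : ℝ → (H1 →L[ℂ] H1))
    (hA : ∀ (t : ℝ) (f : H1), ⇑(A t f) =ᵐ[volume] fun x => f (x + t))
    (hAadj : ∀ (t : ℝ) (f : H1),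
      ⇑((ContinuousLinearMap.adjoint (A t)) f) =ᵐ[volume] fun x => f (x - t))
    (Ba : H1 →L[ℂ] H1)
    (hBa : ∀ f : H1, ⇑(Ba f) =ᵐ[volume] fun x => (a x : ℂ) * f x)
    (F : ℝ → (H1 →L[ℂ] H1))
    (hF : ∀ t : ℝ, F t = (A (t ^ (1 / (2 * (k : ℝ)))) - 1) ^ k * Ba *
      (1 - ContinuousLinearMap.adjoint (A (t ^ (1 / (2 * (k : ℝ)))))) ^ k)
    -- Φ is φ viewed as an element of L²(ℝ)
    (Φ : H1) (hΦ : ⇑Φ =ᵐ[volume] fun x => (φ x : ℂ))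
    -- ψ is (d^k/dx^k)(a·φ^{(k)}) viewed as an element of L²(ℝ)
    (ψ : H1) (hψ : ⇑ψ =ᵐ[volume] fun x =>
      (iteratedDeriv k (fun y => a y * iteratedDeriv k φ y) x : ℂ)) :
    Filter.Tendsto
      (fun t : ℝ => t⁻¹ * ‖F t Φ - ((t : ℝ) : ℂ) • ψ‖)
      (𝓝[>] (0 : ℝ)) (𝓝 0) := by
  have hle : ∀ m : ℕ, (m : WithTop ℕ∞) ≤ ((⊤ : ℕ∞) : WithTop ℕ∞) := fun m => by
    exact_mod_cast le_top
  have hak : ContDiff ℝ k a := ha.of_le (by exact_mod_cast (by omega : k ≤ 2 * k))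
  have hck : ContDiff ℝ k (fun y => a y * iteratedDeriv k φ y) :=
    hak.mul ((smooth_iteratedDeriv k φ hφ).of_le (hle k))
  set p : ℝ → ℝ := iteratedDeriv k (fun y => a y * iteratedDeriv k φ y) with hp
  have hpc : Continuous p := hck.continuous_iteratedDeriv k le_rfl
  have hψ' : ⇑ψ =ᵐ[volume] fun x => (p x : ℂ) := by
    have h1 := iteratedDeriv_ofReal' k _ hck
    have h2 : (fun y => (a y : ℂ) * ((iteratedDeriv k φ y : ℝ) : ℂ)) =
        fun y => ((a y * iteratedDeriv k φ y : ℝ) : ℂ) := by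
      funext y
      push_cast
      rfl
    rw [h2, h1] at hψ
    exact hψ
  set w : ℝ → ℝ → ℝ := fun s => (Df s 0)^[k] (fun y => a y * (Df 0 (-s))^[k] φ y) with hw
  have hwc : ∀ s, Continuous (w s) := fun s =>
    (Df_contDiff s 0 k k _ (hak.mul (Df_contDiff _ _ _ _ _ (hφ.of_le (hle k))))).continuous
  -- the operator computation
  have hFw : ∀ t : ℝ, ⇑(F t Φ) =ᵐ[volume]
      fun x => (w (t ^ (1 / (2 * (k : ℝ)))) x : ℂ) := by
    intro t
    rw [hF t]
    set s := t ^ (1 / (2 * (k : ℝ)))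
    have e1 := op_iter (1 - ContinuousLinearMap.adjoint (A s)) 0 (-s) (by
      intro f g hfg
      have h1 : ⇑((1 - ContinuousLinearMap.adjoint (A s)) f) =ᵐ[volume]
        ⇑f - ⇑((ContinuousLinearMap.adjoint (A s)) f) := Lp.coeFn_sub _ _
      filter_upwards [h1, hAadj s f, ae_shift f g hfg (-s), hfg] with x h1 h2 h3 h4
      rw [h1, Pi.sub_apply, h2, h4, sub_eq_add_neg x s, h3]
      simp [Df]) k Φ φ hΦ
    have e2 : ⇑(Ba (((1 - ContinuousLinearMap.adjoint (A s)) ^ k) Φ)) =ᵐ[volume]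
        fun x => ((a x * (Df 0 (-s))^[k] φ x : ℝ) : ℂ) := by
      filter_upwards [hBa (((1 - ContinuousLinearMap.adjoint (A s)) ^ k) Φ), e1] with x h1 h2
      rw [h1, h2]
      push_cast
      rfl
    exact op_iter (A s - 1) s 0 (by
      intro f g hfg
      have h1 : ⇑((A s - 1) f) =ᵐ[volume] ⇑(A s f) - ⇑f := Lp.coeFn_sub _ _
      filter_upwards [h1, hA s f, ae_shift f g hfg s, hfg] with x h1 h2 h3 h4
      rw [h1, Pi.sub_apply, h2, h4, h3]
      simp [Df]) k _ _ e2
  -- dominated convergence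
  obtain ⟨M, R, hMR⟩ := bound_rep k a φ hak (fun i hi => ha_bdd i (by omega)) hφ hφc
  have hT := tendsto_rep k a φ hak hφ
  have hpb : ∀ x, |p x| ≤ (Metric.closedBall (0 : ℝ) R).indicator (fun _ => M) x := fun x => by
    refine le_of_tendsto (hT x).abs ?_
    filter_upwards [Ioc_mem_nhdsGT (zero_lt_one' ℝ)] with s hs
    exact hMR s hs.1 hs.2 x
  have hG : Tendsto (fun s : ℝ => ∫ x, ((s ^ (2 * k))⁻¹ * w s x - p x) ^ 2) (𝓝[>] 0) (𝓝 0) := by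
    have : Tendsto (fun s : ℝ => ∫ x, ((s ^ (2 * k))⁻¹ * w s x - p x) ^ 2) (𝓝[>] 0)
        (𝓝 (∫ _ : ℝ, (0 : ℝ))) := by
      refine tendsto_integral_filter_of_dominated_convergence
        ((Metric.closedBall (0 : ℝ) R).indicator (fun _ => (2 * M) ^ 2)) ?_ ?_ ?_ ?_
      · exact Eventually.of_forall fun s =>
          (((continuous_const.mul (hwc s)).sub hpc).pow 2).aestronglyMeasurable
      · filter_upwards [Ioc_mem_nhdsGT (zero_lt_one' ℝ)] with s hs
        refine Eventually.of_forall fun x => ?_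
        have h1 := hMR s hs.1 hs.2 x
        have h2 := hpb x
        have h3 := (abs_sub _ _).trans (add_le_add h1 h2)
        rw [Real.norm_eq_abs, abs_pow]
        by_cases hx : x ∈ Metric.closedBall (0 : ℝ) R
        · simp only [Set.indicator_of_mem hx] at h3 ⊢
          have h4 : M + M = 2 * M := by ring
          rw [h4] at h3
          exact pow_le_pow_left₀ (abs_nonneg _) h3 2
        · simp only [Set.indicator_of_notMem hx] at h3 ⊢
          have h5 := le_antisymm (h3.trans_eq (add_zero 0)) (abs_nonneg _)
          exact (by rw [h5]; norm_num : _ ^ 2 = (0 : ℝ)).le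
      · rw [integrable_indicator_iff Metric.isClosed_closedBall.measurableSet]
        exact integrableOn_const (isCompact_closedBall _ _).measure_lt_top.ne
      · refine Eventually.of_forall fun x => ?_
        have := ((hT x).sub_const (p x)).pow 2
        simpa [hp] using this
    simpa using this
  have hk0 : (0 : ℝ) < 1 / (2 * (k : ℝ)) := by
    have : (0 : ℝ) < k := by exact_mod_cast hk
    positivity
  have hs : Tendsto (fun t : ℝ => t ^ (1 / (2 * (k : ℝ)))) (𝓝[>] 0) (𝓝[>] 0) := by
    refine tendsto_nhdsWithin_iff.2 ⟨?_, ?_⟩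
    · have := (Real.continuousAt_rpow_const 0 (1 / (2 * (k : ℝ))) (Or.inr hk0.le)).tendsto
      rw [Real.zero_rpow hk0.ne'] at this
      exact this.mono_left nhdsWithin_le_nhds
    · filter_upwards [self_mem_nhdsWithin] with t ht
      exact Real.rpow_pos_of_pos ht _
  have hfin := (hG.comp hs).sqrt
  rw [Real.sqrt_zero] at hfin
  refine hfin.congr' ?_
  filter_upwards [self_mem_nhdsWithin] with t ht
  have ht' : (0 : ℝ) < t := ht
  have hpow : (t ^ (1 / (2 * (k : ℝ)))) ^ (2 * k) = t := by
    rw [← Real.rpow_natCast, ← Real.rpow_mul ht'.le]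
    have : 1 / (2 * (k : ℝ)) * ((2 * k : ℕ) : ℝ) = 1 := by
      have : (k : ℝ) ≠ 0 := by
        have : (0 : ℝ) < k := by exact_mod_cast hk
        exact this.ne'
      push_cast
      field_simp
    rw [this, Real.rpow_one]
  simp only [Function.comp]
  rw [hpow]
  have hn := norm_sq_L2 (F t Φ - ((t : ℝ) : ℂ) • ψ)
    (fun x => w (t ^ (1 / (2 * (k : ℝ)))) x - t * p x) (by
      filter_upwards [Lp.coeFn_sub (F t Φ) (((t : ℝ) : ℂ) • ψ),
        Lp.coeFn_smul ((t : ℝ) : ℂ) ψ, hFw t, hψ'] with x h1 h2 h3 h4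
      rw [h1, Pi.sub_apply, h2, h3, Pi.smul_apply, h4]
      simp)
  rw [Real.sqrt_eq_iff_eq_sq (integral_nonneg fun _ => sq_nonneg _) (by positivity), mul_pow, hn,
    ← integral_const_mul]
  congr 1
  funext x
  field_simp
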